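/- arXiv:math/0702098 — 2 statements merged into one kernel-verified Lean document; each statement's English description precedes it below -/
import Mathlib

section
/- Let Ω ⊆ ℝ² be an open connected set and let F, M : Ω → ℝ be differentiable functions with F(p)² < 1 for every p ∈ Ω. Define H : Ω → ℝ by H(p) = −F(p)·M(p)/(1 − F(p)²), and assume the Peterson–Mainardi–Codazzi relations hold: for j = 1, 2 and every p ∈ Ω, ∂ⱼM(p) = H(p)·∂ⱼF(p). Then the function p ↦ M(p)²/(1 − F(p)²) is constant on Ω. -/
/-- If `F, M : Ω → ℝ` are differentiable on an open connected `Ω ⊆ ℝ²`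
with `F² < 1`, `H = -F·M/(1-F²)`, and the Peterson–Mainardi–Codazzi relations
`∂ⱼM = H·∂ⱼF` hold on `Ω` for `j = 1, 2`, then `M²/(1-F²)` is constant on `Ω`. -/
theorem pmc_implies_constant_curvature
    (Ω : Set (ℝ × ℝ)) (hΩopen : IsOpen Ω) (hΩconn : IsConnected Ω)
    (F M : ℝ × ℝ → ℝ)
    (hF : ∀ p ∈ Ω, DifferentiableAt ℝ F p)
    (hM : ∀ p ∈ Ω, DifferentiableAt ℝ M p)
    (hF1 : ∀ p ∈ Ω, (F p) ^ 2 < 1)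
    (H : ℝ × ℝ → ℝ)
    (hH : ∀ p ∈ Ω, H p = -(F p * M p) / (1 - (F p) ^ 2))
    (hPMC1 : ∀ p ∈ Ω, fderiv ℝ M p (1, 0) = H p * fderiv ℝ F p (1, 0))
    (hPMC2 : ∀ p ∈ Ω, fderiv ℝ M p (0, 1) = H p * fderiv ℝ F p (0, 1)) :
    ∃ c : ℝ, ∀ p ∈ Ω, (M p) ^ 2 / (1 - (F p) ^ 2) = c := by
  have hfderiv : ∀ p ∈ Ω, HasFDerivAt (fun q => (M q) ^ 2 / (1 - (F q) ^ 2))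
      (0 : ℝ × ℝ →L[ℝ] ℝ) p := by
    intro p hp
    have hne : 1 - (F p) ^ 2 ≠ 0 := (sub_pos.mpr (hF1 p hp)).ne'
    have hMF : fderiv ℝ M p = H p • fderiv ℝ F p := by
      ext
      · simpa using hPMC1 p hp
      · simpa using hPMC2 p hp
    have hM' := (hM p hp).hasFDerivAt
    rw [hMF, hH p hp] at hM'
    have hF' := (hF p hp).hasFDerivAt
    have hinv := (hasDerivAt_inv hne).comp_hasFDerivAt p ((hF'.pow 2).const_sub 1)
    simp only [div_eq_mul_inv]
    refine ((hM'.pow 2).mul hinv).congr_fderiv ?_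
    ext <;> simp <;> field_simp <;> ring
  exact hΩopen.exists_is_const_of_fderiv_eq_zero hΩconn.isPreconnected
    (fun p hp => (hfderiv p hp).differentiableAt.differentiableWithinAt)
    (fun p hp => (hfderiv p hp).fderiv)
end

section
/- Let a > 0, let φ, ψ ∈ (0, π), and let A, B, C, D ∈ ℝ³ satisfy ‖B−A‖ = ‖D−A‖ = ‖C−B‖ = ‖C−D‖ = a, with the angle between the vectors B−A and D−A equal to φ and the angle between the vectors A−D and C−D equal to ψ. Then cos φ + cos ψ ≥ 0 and |det(B−A, C−A, D−A)| = 4a³ · sin(φ/2) · sin(ψ/2) · √((cos φ + cos ψ)/2), where det(u, v, w) denotes the determinant of the 3×3 matrix with columns u, v, w. -/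
noncomputable section
open RealInnerProductSpace Matrix Real

/-- Determinant of the 3×3 matrix with columns `u`, `v`, `w`. -/
def det3 (u v w : EuclideanSpace ℝ (Fin 3)) : ℝ :=
  Matrix.det (Matrix.of ![(u : Fin 3 → ℝ), v, w])ᵀ

/-- The square of the determinant is the Gram determinant; the middle column may be sheared
along the last one. -/
theorem det3_add_sq (u v w : EuclideanSpace ℝ (Fin 3)) :
    det3 u (v + w) v ^ 2 =
      inner ℝ u u * inner ℝ v v * inner ℝ w w + 2 * inner ℝ u v * inner ℝ v w * inner ℝ u w
        - inner ℝ u u * inner ℝ v w ^ 2 - inner ℝ v v * inner ℝ u w ^ 2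
        - inner ℝ w w * inner ℝ u v ^ 2 := by
  simp only [det3, Matrix.det_transpose, Matrix.det_fin_three, PiLp.inner_apply,
    Fin.sum_univ_three, RCLike.inner_apply, conj_trivial]
  simp
  ring

/-- For the tetrahedron `ABCD` with `|AB| = |AD| = |BC| = |CD| = a`,
angle `φ` between `B-A` and `D-A`, and angle `ψ` between `A-D` and `C-D`, one has
`cos φ + cos ψ ≥ 0` and
`|det(B-A, C-A, D-A)| = 4a³ sin(φ/2) sin(ψ/2) √((cos φ + cos ψ)/2)`. -/
theorem tetrahedron_det_formula
    (a : ℝ) (ha : 0 < a) (φ ψ : ℝ)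
    (hφ : φ ∈ Set.Ioo 0 π) (hψ : ψ ∈ Set.Ioo 0 π)
    (A B C D : EuclideanSpace ℝ (Fin 3))
    (hAB : ‖B - A‖ = a) (hAD : ‖D - A‖ = a)
    (hBC : ‖C - B‖ = a) (hCD : ‖C - D‖ = a)
    (hangA : InnerProductGeometry.angle (B - A) (D - A) = φ)
    (hangD : InnerProductGeometry.angle (A - D) (C - D) = ψ) :
    0 ≤ Real.cos φ + Real.cos ψ ∧
    |det3 (B - A) (C - A) (D - A)| =
      4 * a ^ 3 * Real.sin (φ / 2) * Real.sin (ψ / 2) *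
        Real.sqrt ((Real.cos φ + Real.cos ψ) / 2) := by
  have hCA : C - A = (D - A) + (C - D) := by abel
  have hCB : C - B = (D - A) + (C - D) - (B - A) := by abel
  have hDA : A - D = -(D - A) := by abel
  rw [hCA]
  rw [hCB] at hBC
  rw [hDA] at hangD
  generalize B - A = u at *
  generalize D - A = v at *
  generalize C - D = w at *
  have huv : inner ℝ u v = a ^ 2 * Real.cos φ := by
    rw [← InnerProductGeometry.cos_angle_mul_norm_mul_norm, hangA, hAB, hAD]
    ring
  have hvw : inner ℝ v w = -(a ^ 2 * Real.cos ψ) := by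
    have h := InnerProductGeometry.cos_angle_mul_norm_mul_norm (-v) w
    rw [hangD, norm_neg, hAD, hCD, inner_neg_left] at h
    linarith
  have huu : inner ℝ u u = a ^ 2 := by rw [real_inner_self_eq_norm_sq, hAB]
  have hvv : inner ℝ v v = a ^ 2 := by rw [real_inner_self_eq_norm_sq, hAD]
  have hww : inner ℝ w w = a ^ 2 := by rw [real_inner_self_eq_norm_sq, hCD]
  have huw : inner ℝ u w = a ^ 2 * (1 - Real.cos φ - Real.cos ψ) := by
    have h := real_inner_self_eq_norm_sq (v + w - u)
    rw [hBC] at h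
    simp only [inner_add_left, inner_add_right, inner_sub_left, inner_sub_right,
      real_inner_comm u v, real_inner_comm u w, real_inner_comm v w,
      huu, hvv, hww, huv, hvw] at h
    linarith [real_inner_comm u w]
  have hcos : 0 ≤ Real.cos φ + Real.cos ψ := by
    have h := real_inner_le_norm u w
    rw [huw, hAB, hCD] at h
    have : 0 < a ^ 2 := by positivity
    nlinarith
  have hsφ : 0 ≤ Real.sin (φ / 2) :=
    Real.sin_nonneg_of_nonneg_of_le_pi (by linarith [hφ.1]) (by linarith [hφ.1, hφ.2])
  have hsψ : 0 ≤ Real.sin (ψ / 2) :=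
    Real.sin_nonneg_of_nonneg_of_le_pi (by linarith [hψ.1]) (by linarith [hψ.1, hψ.2])
  have half (x : ℝ) : Real.sin (x / 2) ^ 2 = (1 - Real.cos x) / 2 := by
    rw [Real.sin_sq_eq_half_sub, mul_div_cancel₀ x two_ne_zero]
    ring
  refine ⟨hcos, ?_⟩
  rw [← sq_eq_sq₀ (abs_nonneg _) (by positivity), sq_abs, det3_add_sq, huu, hvv, hww, huv, hvw,
    huw]
  simp only [mul_pow, Real.sq_sqrt (div_nonneg hcos zero_le_two), half]
  ring
end
end
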